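/- Fix d > 0. For all sufficiently large n there exists a random non-prefix d-semifaithful code (φ_n, f_n, g_n) in the universal distortion setting such that, uniformly over all source distributions p ∈ P(A) and all distortion measures ρ ∈ D, (1/n)·E_p[ ln(2)·E_c[ l(f_n(φ_n(X^n, ρ))) ] ] − E_p[R(T,d,ρ)] ≤ (2ρ_max ln n)/(d·n^{5/8}) + 4ρ_max(min(ln K, ln J) + ln 2)/(d·n^{5/8}) + ((K + 5/4)/2)·(ln n)/n + (V₁ + ln 8)/n + min(ln K, ln J)/n, where V₁ = ln( Γ(1/2)^K / ((2π)^{(K−1)/2} Γ(K/2)) ) + 2 ln 2. -/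

import Mathlib

open Filter MeasureTheory
open scoped BigOperators

noncomputable section

variable {A B : Type*}

/-- `p` is a probability distribution on the finite alphabet `A`. -/
def IsProb [Fintype A] (p : A → ℝ) : Prop :=
  (∀ a, 0 ≤ p a) ∧ ∑ a, p a = 1

/-- `Q` is a conditional probability distribution from `A` to `B`. -/
def IsCondProb [Fintype A] [Fintype B] (Q : A → B → ℝ) : Prop :=
  ∀ j, IsProb (Q j)

/-- `ρ` is a distortion measure in the class `D`: bounded in `[0, ρmax]` and
with `max_j min_k ρ(j,k) = 0` (equivalently, every row contains a zero). -/
def IsDistMeasure [Fintype A] [Fintype B] (ρmax : ℝ) (ρ : A → B → ℝ) : Prop :=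
  (∀ j k, 0 ≤ ρ j k ∧ ρ j k ≤ ρmax) ∧ ∀ j, ∃ k, ρ j k = 0

/-- Mutual information `I(p, Q)` in nats. -/
def mutualInfo [Fintype A] [Fintype B] (p : A → ℝ) (Q : A → B → ℝ) : ℝ :=
  ∑ j, ∑ k, p j * Q j k * Real.log (Q j k / ∑ j', p j' * Q j' k)

/-- Average distortion `Σ_{j,k} p(j) Q(k|j) ρ(j,k)`. -/
def avgDist [Fintype A] [Fintype B] (p : A → ℝ) (Q : A → B → ℝ) (ρ : A → B → ℝ) : ℝ :=
  ∑ j, ∑ k, p j * Q j k * ρ j k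

/-- The rate-distortion function `R(p,d,ρ)` in nats. -/
def RD [Fintype A] [Fintype B] (p : A → ℝ) (d : ℝ) (ρ : A → B → ℝ) : ℝ :=
  sInf { r | ∃ Q, IsCondProb Q ∧ avgDist p Q ρ ≤ d ∧ r = mutualInfo p Q }

/-- The type (empirical distribution) of a sequence `x ∈ A^n`. -/
def typeOf [DecidableEq A] {n : ℕ} (x : Fin n → A) : A → ℝ :=
  fun a => ((Finset.univ.filter fun i => x i = a).card : ℝ) / n

/-- The i.i.d. product probability `p^n(x) = ∏ i p(x_i)`. -/
def prodProb {n : ℕ} (p : A → ℝ) (x : Fin n → A) : ℝ :=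
  ∏ i, p (x i)

/-- The `n`-fold single-letter distortion `ρ_n(x,y) = (1/n) Σ_i ρ(x_i, y_i)`. -/
def nDist {n : ℕ} (ρ : A → B → ℝ) (x : Fin n → A) (y : Fin n → B) : ℝ :=
  (∑ i, ρ (x i) (y i)) / n

/-- `E_p[R(T,d,ρ)]`, the expectation of the empirical rate-distortion function
over `X^n` i.i.d. `p` (written as a sum over sequences). -/
def expTypeRD [Fintype A] [DecidableEq A] [Fintype B] (n : ℕ) (p : A → ℝ)
    (d : ℝ) (ρ : A → B → ℝ) : ℝ :=
  ∑ x : Fin n → A, prodProb p x * RD (typeOf x) d ρ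


/-- number of occurrences of `a` in `z`. -/
def occ {α : Type*} [DecidableEq α] {n : ℕ} (z : Fin n → α) (a : α) : ℕ :=
  (Finset.univ.filter fun i => z i = a).card

lemma occ_succ {α : Type*} [DecidableEq α] {n : ℕ} (z : Fin (n + 1) → α) (a : α) :
    occ z a = (if z 0 = a then 1 else 0) + occ (fun i => z i.succ) a := by
  unfold occ
  exact Fin.card_filter_univ_succ' _

lemma prod_fact_step {ι : Type*} [Fintype ι] [DecidableEq ι] (f g : ι → ℕ) (i₀ : ι)
    (h0 : f i₀ = g i₀ + 1) (h : ∀ i, i ≠ i₀ → f i = g i) :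
    ∏ i, (f i).factorial = f i₀ * ∏ i, (g i).factorial := by
  rw [← Finset.mul_prod_erase Finset.univ (fun i => (f i).factorial) (Finset.mem_univ i₀),
    ← Finset.mul_prod_erase Finset.univ (fun i => (g i).factorial) (Finset.mem_univ i₀)]
  have : ∏ i ∈ Finset.univ.erase i₀, (f i).factorial
      = ∏ i ∈ Finset.univ.erase i₀, (g i).factorial := by
    apply Finset.prod_congr rfl
    intro i hi
    rw [h i (Finset.ne_of_mem_erase hi)]
  simp only [this, h0, Nat.factorial_succ]
  ring

/-- sequences `y` with prescribed joint counts `c` with `x`. -/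
def shell {α β : Type*} [DecidableEq α] [DecidableEq β] [Fintype α] [Fintype β] {n : ℕ}
    (x : Fin n → α) (c : α × β → ℕ) : Finset (Fin n → β) :=
  Finset.univ.filter fun y => ∀ p, occ (fun i => (x i, y i)) p = c p

lemma shell_card {α β : Type*} [DecidableEq α] [DecidableEq β] [Fintype α] [Fintype β] :
    ∀ (n : ℕ) (x : Fin n → α) (c : α × β → ℕ), (∀ j, ∑ k, c (j, k) = occ x j) →
      (shell x c).card * ∏ p, (c p).factorial = ∏ j, (occ x j).factorial := by
  intro n
  induction n with
  | zero =>
    intro x c hc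
    have h0 : ∀ j, occ x j = 0 := by intro j; simp [occ]
    have hc0 : ∀ p, c p = 0 := by
      rintro ⟨j, k⟩
      have := hc j
      rw [h0] at this
      exact (Finset.sum_eq_zero_iff.mp this) k (Finset.mem_univ _)
    have : shell x c = Finset.univ := by
      ext y
      simp [shell, hc0, occ]
    simp [this, hc0, h0]
  | succ n ih =>
    intro x c hc
    set xs : Fin n → α := fun i => x i.succ with hxs
    set W : ℕ := ∏ j, (occ xs j).factorial with hW
    have hcard : (shell x c).card = ∑ k : β, ((shell x c).filter fun y => y 0 = k).card := by
      apply Finset.card_eq_sum_card_fiberwise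
      intro y _
      simp
    have hx : ∏ j, (occ x j).factorial = occ x (x 0) * W := by
      apply prod_fact_step
      · rw [occ_succ]; simp [hxs]; ring
      · intro i hi
        rw [occ_succ, if_neg (Ne.symm hi)]; simp [hxs]
    rw [hcard, Finset.sum_mul, hx, ← hc, Finset.sum_mul]
    apply Finset.sum_congr rfl
    intro k _
    by_cases hk : c (x 0, k) = 0
    · have : (shell x c).filter (fun y => y 0 = k) = ∅ := by
        rw [Finset.filter_eq_empty_iff]
        intro y hy hyk
        simp only [shell, Finset.mem_filter] at hy
        have h1 := hy.2 (x 0, k)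
        rw [occ_succ, hyk] at h1
        simp at h1
        omega
      rw [this, hk]; simp
    · set c' : α × β → ℕ := fun p => if p = (x 0, k) then c p - 1 else c p with hc'
      have hstep : ∏ p, (c p).factorial = c (x 0, k) * ∏ p, (c' p).factorial := by
        apply prod_fact_step
        · simp [hc']; omega
        · intro p hp; simp [hc', hp]
      have hfib : ((shell x c).filter fun y => y 0 = k).card = (shell xs c').card := by
        symm
        apply Finset.card_bij (fun (ys : Fin n → β) _ => (Fin.cons k ys : Fin (n + 1) → β))
        · intro ys hys
          simp only [shell, Finset.mem_filter, Finset.mem_univ, true_and] at hys ⊢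
          refine ⟨fun p => ?_, by simp⟩
          rw [occ_succ]
          simp only [Fin.cons_zero, Fin.cons_succ]
          have := hys p
          simp only [hxs] at this
          rw [this]
          by_cases hp : p = (x 0, k)
          · subst hp; simp [hc']; omega
          · simp [hc', hp, Ne.symm hp]
        · intro a _ b _ hab
          exact (Fin.cons_injective2 hab).2
        · intro y hy
          simp only [shell, Finset.mem_filter, Finset.mem_univ, true_and] at hy
          obtain ⟨hy1, hy2⟩ := hy
          refine ⟨fun i => y i.succ, ?_, ?_⟩
          · simp only [shell, Finset.mem_filter, Finset.mem_univ, true_and]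
            intro p
            have := hy1 p
            rw [occ_succ, hy2] at this
            simp only [hxs]
            by_cases hp : p = (x 0, k)
            · subst hp
              simp at this
              simp [hc']; omega
            · simp [Ne.symm hp] at this
              simp [hc', hp, this]
          · subst hy2
            exact Fin.cons_self_tail y
      have hih := ih xs c' (by
        intro j
        by_cases hj : j = x 0
        · subst hj
          have h1 := hc (x 0)
          rw [occ_succ] at h1
          simp only [if_true] at h1
          have h2 : ∑ k', c (x 0, k') = 1 + ∑ k', c' (x 0, k') := by
            rw [← Finset.add_sum_erase Finset.univ (fun k' => c (x 0, k')) (Finset.mem_univ k),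
              ← Finset.add_sum_erase Finset.univ (fun k' => c' (x 0, k')) (Finset.mem_univ k)]
            have : ∑ k' ∈ Finset.univ.erase k, c (x 0, k')
                = ∑ k' ∈ Finset.univ.erase k, c' (x 0, k') := by
              apply Finset.sum_congr rfl
              intro k' hk'
              simp [hc', Finset.ne_of_mem_erase hk']
            rw [this]
            simp [hc']; omega
          simp only [hxs]; omega
        · have h1 := hc j
          rw [occ_succ, if_neg (Ne.symm hj)] at h1
          simp only [hxs]
          rw [← Nat.zero_add (occ _ j), ← h1]
          apply Finset.sum_congr rfl
          intro k' _
          simp [hc', hj])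
      rw [hfib, hstep, hW, ← hih]
      ring

/-- greedy covering -/
lemma greedy_cover {ι Y : Type*} [Fintype ι] [Fintype Y] [Nonempty Y] [DecidableEq ι]
    [DecidableEq Y]
    (w : Y → ℝ) (hw : ∀ y, 0 ≤ w y) (hw1 : ∑ y, w y ≤ 1) (G : ι → Finset Y) (U₀ : Finset ι)
    (q : ℝ) (hq1 : q ≤ 1) (hU : ∀ u ∈ U₀, q ≤ ∑ y ∈ G u, w y) :
    ∀ m : ℕ, ∃ D : ℕ → Y,
      ((U₀.filter fun u => ∀ i < m, D i ∉ G u).card : ℝ) ≤ U₀.card * (1 - q) ^ m := by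
  intro m
  induction m with
  | zero => exact ⟨fun _ => Classical.arbitrary Y, by simp⟩
  | succ m ih =>
    obtain ⟨D, hD⟩ := ih
    set U := U₀.filter fun u => ∀ i < m, D i ∉ G u with hUdef
    obtain ⟨y, -, hy⟩ := Finset.exists_max_image Finset.univ
      (fun y : Y => (U.filter fun u => y ∈ G u).card) Finset.univ_nonempty
    have key : q * U.card ≤ (U.filter fun u => y ∈ G u).card := by
      calc q * U.card = ∑ u ∈ U, q := by simp [mul_comm]
        _ ≤ ∑ u ∈ U, ∑ z ∈ G u, w z :=
            Finset.sum_le_sum fun u hu => hU u (Finset.mem_filter.mp hu).1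
        _ = ∑ u ∈ U, ∑ z, if z ∈ G u then w z else 0 := by
            apply Finset.sum_congr rfl; intro u _; simp
        _ = ∑ z, w z * ((U.filter fun u => z ∈ G u).card : ℝ) := by
            rw [Finset.sum_comm]
            apply Finset.sum_congr rfl; intro z _
            rw [← Finset.sum_filter]; simp [mul_comm]
        _ ≤ ∑ z, w z * ((U.filter fun u => y ∈ G u).card : ℝ) := by
            apply Finset.sum_le_sum; intro z hz
            apply mul_le_mul_of_nonneg_left _ (hw z)
            exact_mod_cast hy z hz
        _ = (∑ z, w z) * ((U.filter fun u => y ∈ G u).card : ℝ) := by rw [Finset.sum_mul]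
        _ ≤ 1 * ((U.filter fun u => y ∈ G u).card : ℝ) := by gcongr
        _ = _ := one_mul _
    refine ⟨Function.update D m y, ?_⟩
    have hset : (U₀.filter fun u => ∀ i < m + 1, Function.update D m y i ∉ G u)
        = U.filter fun u => ¬ y ∈ G u := by
      ext u
      simp only [hUdef, Finset.mem_filter, and_assoc]
      apply and_congr_right
      intro _
      constructor
      · intro h
        refine ⟨fun i hi => ?_, ?_⟩
        · have := h i (by omega)
          rwa [Function.update_of_ne (by omega)] at this
        · have := h m (by omega)
          rwa [Function.update_self] at this
      · rintro ⟨h1, h2⟩ i hi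
        by_cases him : i = m
        · subst him; rwa [Function.update_self]
        · rw [Function.update_of_ne him]; exact h1 i (by omega)
    rw [hset]
    have hsplit := Finset.card_filter_add_card_filter_not (s := U) (fun u => y ∈ G u)
    have hsplit' : ((U.filter fun u => y ∈ G u).card : ℝ)
        + ((U.filter fun u => ¬ y ∈ G u).card : ℝ) = U.card := by exact_mod_cast hsplit
    calc ((U.filter fun u => ¬ y ∈ G u).card : ℝ) ≤ (1 - q) * U.card := by linarith
      _ ≤ (1 - q) * (U₀.card * (1 - q) ^ m) := by
          apply mul_le_mul_of_nonneg_left hD; linarith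
      _ = _ := by ring

lemma log_fact_lower (a : ℕ) : (a : ℝ) * Real.log a - a ≤ Real.log a.factorial := by
  induction a with
  | zero => simp
  | succ a ih =>
    rw [Nat.factorial_succ]
    push_cast
    rw [Real.log_mul (by positivity) (by positivity)]
    rcases Nat.eq_zero_or_pos a with h | h
    · subst h; simp
    · have ha : (0 : ℝ) < a := by exact_mod_cast h
      have : Real.log ((a + 1) / a) ≤ (a + 1) / a - 1 :=
        Real.log_le_sub_one_of_pos (by positivity)
      rw [Real.log_div (by positivity) (by positivity)] at this
      have h2 : (a : ℝ) * ((a + 1) / a - 1) = 1 := by field_simp; ring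
      nlinarith

lemma log_fact_upper (a : ℕ) :
    Real.log a.factorial ≤ (a : ℝ) * Real.log a - a + Real.log (a + 1) + 1 := by
  rcases Nat.eq_zero_or_pos a with h | h
  · subst h; simp
  have key : ∀ b : ℕ, 1 ≤ b →
      Real.log b.factorial ≤ (b : ℝ) * Real.log b - b + Real.log b + 1 := by
    intro b hb
    induction b, hb using Nat.le_induction with
    | base => simp
    | succ b hb ih =>
      rw [Nat.factorial_succ]
      push_cast
      rw [Real.log_mul (by positivity) (by positivity)]
      have hb' : (0 : ℝ) < b := by exact_mod_cast hb
      have : Real.log (b / (b + 1)) ≤ b / (b + 1) - 1 :=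
        Real.log_le_sub_one_of_pos (by positivity)
      rw [Real.log_div (by positivity) (by positivity)] at this
      have h2 : ((b : ℝ) + 1) * (b / (b + 1) - 1) = -1 := by field_simp; ring
      nlinarith
  have := key a h
  have h3 : Real.log a ≤ Real.log (a + 1) :=
    Real.log_le_log (by exact_mod_cast h) (by linarith)
  linarith

/-- quantitative continuity of `x log x` -/
lemma xlogx_diff {a b L N : ℝ} (ha : 0 ≤ a) (hb : 0 ≤ b) (haN : a ≤ N) (hbN : b ≤ N)
    (hN : 1 ≤ N) (hL : |a - b| ≤ L) :
    a * Real.log a ≤ b * Real.log b + L * (Real.log N + 1) + 1 := by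
  have hlogN : 0 ≤ Real.log N := Real.log_nonneg hN
  have hL0 : 0 ≤ L := le_trans (abs_nonneg _) hL
  obtain ⟨h1, h2⟩ := abs_le.mp hL
  rcases ha.eq_or_lt with h | h
  · subst h
    simp only [zero_mul]
    rcases hb.eq_or_lt with h' | h'
    · subst h'; simp; positivity
    · have := Real.log_le_sub_one_of_pos (inv_pos.mpr h')
      rw [Real.log_inv] at this
      have h3 : b * b⁻¹ = 1 := mul_inv_cancel₀ h'.ne'
      have : 0 ≤ L * (Real.log N + 1) := by positivity
      nlinarith
  · have hla : Real.log a ≤ Real.log N := Real.log_le_log h haN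
    rcases le_total b a with hba | hab
    · -- a log a - b log b ≤ (a-b)(log a + 1)
      have hmain : a * Real.log a ≤ b * Real.log b + (a - b) * (Real.log a + 1) := by
        rcases hb.eq_or_lt with h' | h'
        · subst h'; simp; linarith
        · have := Real.log_le_sub_one_of_pos (div_pos h h')
          rw [Real.log_div h.ne' h'.ne'] at this
          have h3 : b * (a / b) = a := by field_simp
          nlinarith
      have : (a - b) * (Real.log a + 1) ≤ L * (Real.log N + 1) := by
        calc (a - b) * (Real.log a + 1) ≤ (a - b) * (Real.log N + 1) := by
              apply mul_le_mul_of_nonneg_left _ (by linarith); linarith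
          _ ≤ _ := by apply mul_le_mul_of_nonneg_right h2; linarith
      linarith
    · have h' : 0 < b := lt_of_lt_of_le h hab
      have hlab : Real.log a ≤ Real.log b := Real.log_le_log h hab
      have : 0 ≤ L * (Real.log N + 1) := by positivity
      rcases le_total 1 b with hb1 | hb1
      · have : 0 ≤ Real.log b := Real.log_nonneg hb1
        nlinarith
      · have h4 := Real.log_le_sub_one_of_pos (inv_pos.mpr h')
        rw [Real.log_inv] at h4
        have h3 : b * b⁻¹ = 1 := mul_inv_cancel₀ h'.ne'
        have h5 : a * Real.log a ≤ 0 := by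
          have := Real.log_nonpos h.le (by linarith : a ≤ 1)
          nlinarith
        nlinarith

lemma prod_occ {α : Type*} [DecidableEq α] [Fintype α] {n : ℕ} (z : Fin n → α) (f : α → ℝ) :
    ∏ i, f (z i) = ∏ a, f a ^ occ z a := by
  rw [← Finset.prod_fiberwise Finset.univ z]
  apply Finset.prod_congr rfl
  intro a _
  rw [Finset.prod_congr rfl (g := fun _ => f a)]
  · simp [occ]
  · intro i hi
    rw [(Finset.mem_filter.mp hi).2]

lemma sum_occ {α : Type*} [DecidableEq α] [Fintype α] {n : ℕ} (z : Fin n → α) (f : α → ℝ) :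
    ∑ i, f (z i) = ∑ a, (occ z a : ℝ) * f a := by
  rw [← Finset.sum_fiberwise Finset.univ z]
  apply Finset.sum_congr rfl
  intro a _
  rw [Finset.sum_congr rfl (g := fun _ => f a)]
  · simp [occ]
  · intro i hi
    rw [(Finset.mem_filter.mp hi).2]

lemma sum_occ_eq {α : Type*} [DecidableEq α] [Fintype α] {n : ℕ} (z : Fin n → α) :
    ∑ a, occ z a = n := by
  have := sum_occ z (fun _ => 1)
  simp at this
  exact_mod_cast this.symm

lemma occ_snd {α β : Type*} [DecidableEq α] [DecidableEq β] [Fintype α] [Fintype β] {n : ℕ}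
    (x : Fin n → α) (y : Fin n → β) (k : β) :
    occ y k = ∑ j, occ (fun i => (x i, y i)) (j, k) := by
  unfold occ
  rw [Finset.card_eq_sum_card_fiberwise (f := x) (t := Finset.univ) (by intro i _; simp)]
  apply Finset.sum_congr rfl
  intro j _
  congr 1
  ext i
  simp [and_comm]

/-- The empirical letter distribution with counts `m`. -/
def pmix {β : Type*} [Fintype β] (n : ℕ) (m : β → Fin (n + 1)) (k : β) : ℝ :=
  if ∑ k, (m k : ℕ) = n then (m k : ℝ) / n else 0

/-- The universal mixture of i.i.d. distributions. -/
def wt {β : Type*} [Fintype β] [DecidableEq β] (n : ℕ) (y : Fin n → β) : ℝ :=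
  ((n + 1 : ℝ) ^ Fintype.card β)⁻¹ * ∑ m : β → Fin (n + 1), ∏ i, pmix n m (y i)

lemma pmix_nonneg {β : Type*} [Fintype β] (n : ℕ) (m : β → Fin (n + 1)) (k : β) :
    0 ≤ pmix n m k := by
  unfold pmix; split_ifs <;> positivity

lemma wt_nonneg {β : Type*} [Fintype β] [DecidableEq β] (n : ℕ) (y : Fin n → β) : 0 ≤ wt n y := by
  unfold wt
  apply mul_nonneg (by positivity)
  exact Finset.sum_nonneg fun m _ => Finset.prod_nonneg fun i _ => pmix_nonneg n m _

lemma wt_sum {β : Type*} [Fintype β] [DecidableEq β] (n : ℕ) :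
    ∑ y : Fin n → β, wt n y ≤ 1 := by
  unfold wt
  rw [← Finset.mul_sum, Finset.sum_comm]
  have h : ∀ m : β → Fin (n + 1), ∑ y : Fin n → β, ∏ i, pmix n m (y i) ≤ 1 := by
    intro m
    rw [← Fintype.sum_pow]
    apply pow_le_one₀ (Finset.sum_nonneg fun k _ => pmix_nonneg n m k)
    unfold pmix
    split_ifs with hm
    · rw [← Finset.sum_div]
      have : ∑ k, (m k : ℝ) = n := by exact_mod_cast hm
      rw [this]
      exact div_self_le_one _
    · simp
  calc _ ≤ ((n + 1 : ℝ) ^ Fintype.card β)⁻¹ * ∑ m : β → Fin (n + 1), (1 : ℝ) := by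
        apply mul_le_mul_of_nonneg_left _ (by positivity)
        exact Finset.sum_le_sum fun m _ => h m
    _ = 1 := by
        simp
        field_simp

lemma wt_lower {β : Type*} [Fintype β] [DecidableEq β] {n : ℕ} (y : Fin n → β) :
    ((n + 1 : ℝ) ^ Fintype.card β)⁻¹ * ∏ k, ((occ y k : ℝ) / n) ^ occ y k ≤ wt n y := by
  unfold wt
  apply mul_le_mul_of_nonneg_left _ (by positivity)
  have hle : ∀ k, occ y k ≤ n := fun k => by
    calc occ y k ≤ ∑ k, occ y k := Finset.single_le_sum (fun _ _ => Nat.zero_le _) (Finset.mem_univ k)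
      _ = n := sum_occ_eq y
  set m : β → Fin (n + 1) := fun k => ⟨occ y k, by have := hle k; omega⟩ with hm
  have hp : ∀ k, pmix n m k = (occ y k : ℝ) / n := by
    intro k
    unfold pmix
    rw [if_pos]
    simp [hm, sum_occ_eq]
  have : ∏ k, ((occ y k : ℝ) / n) ^ occ y k = ∏ i, pmix n m (y i) := by
    rw [prod_occ y (pmix n m)]
    simp [hp]
  rw [this]
  exact Finset.single_le_sum (f := fun m : β → Fin (n + 1) => ∏ i, pmix n m (y i))
    (fun m _ => Finset.prod_nonneg fun i _ => pmix_nonneg n m _) (Finset.mem_univ m)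

lemma shell_weight {α β : Type*} [DecidableEq α] [DecidableEq β] [Fintype α] [Fintype β]
    {n : ℕ} (hn : 0 < n) (x : Fin n → α) (c : α × β → ℕ) (hc : ∀ j, ∑ k, c (j, k) = occ x j) :
    0 < ∑ y ∈ shell x c, wt n y ∧
    -Real.log (∑ y ∈ shell x c, wt n y) ≤
      ((Fintype.card β : ℝ) + Fintype.card α * Fintype.card β) * (Real.log (n + 1) + 1)
      + ((n : ℝ) * Real.log n
        - ∑ k, (∑ j, (c (j, k) : ℝ)) * Real.log (∑ j, (c (j, k) : ℝ))
        - ∑ j, (occ x j : ℝ) * Real.log (occ x j)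
        + ∑ p, (c p : ℝ) * Real.log (c p)) := by
  have hnR : (0 : ℝ) < n := by exact_mod_cast hn
  set m : β → ℕ := fun k => ∑ j, c (j, k) with hm
  have hmsum : ∑ k, m k = n := by
    simp only [hm]
    rw [Finset.sum_comm, Finset.sum_congr rfl (fun j _ => hc j)]
    exact sum_occ_eq x
  have hmR : ∀ k, (∑ j, (c (j, k) : ℝ)) = (m k : ℝ) := by intro k; simp [hm]
  have hcard := shell_card n x c hc
  have hpos : 0 < (shell x c).card := by
    rcases Nat.eq_zero_or_pos (shell x c).card with h | h
    · rw [h, zero_mul] at hcard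
      have : 0 < ∏ j, (occ x j).factorial := Finset.prod_pos fun j _ => Nat.factorial_pos _
      omega
    · exact h
  have hposR : (0 : ℝ) < (shell x c).card := by exact_mod_cast hpos
  have hlogcard : Real.log (shell x c).card
      = ∑ j, Real.log (occ x j).factorial - ∑ p, Real.log (c p).factorial := by
    have h1 : ((shell x c).card : ℝ) * ∏ p, ((c p).factorial : ℝ)
        = ∏ j, ((occ x j).factorial : ℝ) := by exact_mod_cast hcard
    have h2 := congrArg Real.log h1
    rw [Real.log_mul hposR.ne' (Finset.prod_ne_zero_iff.mpr fun p _ => by positivity),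
      Real.log_prod (fun p _ => by positivity), Real.log_prod (fun p _ => by positivity)] at h2
    linarith
  set P : ℝ := ∏ k, ((m k : ℝ) / n) ^ m k with hP
  have hPpos' : ∀ k, (((m k : ℝ) / n) ^ m k) ≠ 0 := by
    intro k
    rcases Nat.eq_zero_or_pos (m k) with h | h
    · simp [h]
    · positivity
  have hPpos : 0 < P := by
    apply Finset.prod_pos
    intro k _
    exact lt_of_le_of_ne (by positivity) (Ne.symm (hPpos' k))
  have hlogP : Real.log P = ∑ k, (m k : ℝ) * Real.log (m k) - n * Real.log n := by
    rw [hP, Real.log_prod (fun k _ => hPpos' k)]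
    have : ∀ k, Real.log (((m k : ℝ) / n) ^ m k)
        = (m k : ℝ) * Real.log (m k) - m k * Real.log n := by
      intro k
      rcases Nat.eq_zero_or_pos (m k) with h | h
      · simp [h]
      · have : (0 : ℝ) < m k := by exact_mod_cast h
        rw [Real.log_pow, Real.log_div this.ne' hnR.ne']; ring
    rw [Finset.sum_congr rfl (fun k _ => this k), Finset.sum_sub_distrib, ← Finset.sum_mul]
    have : ∑ k, (m k : ℝ) = n := by exact_mod_cast hmsum
    rw [this]
  set T : ℝ := (shell x c).card * (((n + 1 : ℝ) ^ Fintype.card β)⁻¹ * P) with hT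
  have hTpos : 0 < T := by positivity
  have hle : T ≤ ∑ y ∈ shell x c, wt n y := by
    calc T = ∑ y ∈ shell x c, (((n + 1 : ℝ) ^ Fintype.card β)⁻¹ * P) := by simp [hT]
      _ ≤ _ := by
        apply Finset.sum_le_sum
        intro y hy
        have hy' : ∀ k, occ y k = m k := by
          intro k
          rw [occ_snd x y k]
          simp only [shell, Finset.mem_filter] at hy
          exact Finset.sum_congr rfl fun j _ => hy.2 _
        have := wt_lower y
        simp only [hy'] at this
        exact this
  refine ⟨lt_of_lt_of_le hTpos hle, ?_⟩
  have hlogT : Real.log T ≤ Real.log (∑ y ∈ shell x c, wt n y) := Real.log_le_log hTpos hle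
  have hlogT' : Real.log T = Real.log (shell x c).card
      - Fintype.card β * Real.log (n + 1) + Real.log P := by
    rw [hT, Real.log_mul hposR.ne' (by positivity), Real.log_mul (by positivity) hPpos.ne',
      Real.log_inv, Real.log_pow]
    ring
  have hlow : ∑ j, ((occ x j : ℝ) * Real.log (occ x j) - occ x j)
      ≤ ∑ j, Real.log (occ x j).factorial := Finset.sum_le_sum fun j _ => log_fact_lower _
  have hcle : ∀ p, c p ≤ n := by
    rintro ⟨j, k⟩
    calc c (j, k) ≤ ∑ k, c (j, k) :=
          Finset.single_le_sum (f := fun k => c (j, k)) (fun _ _ => Nat.zero_le _) (Finset.mem_univ k)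
      _ = occ x j := hc j
      _ ≤ ∑ j, occ x j := Finset.single_le_sum (fun _ _ => Nat.zero_le _) (Finset.mem_univ j)
      _ = n := sum_occ_eq x
  have hup : ∑ p, Real.log (c p).factorial
      ≤ ∑ p, ((c p : ℝ) * Real.log (c p) - c p + (Real.log (n + 1) + 1)) := by
    apply Finset.sum_le_sum
    intro p _
    have h1 := log_fact_upper (c p)
    have h2 : Real.log ((c p : ℝ) + 1) ≤ Real.log (n + 1) := by
      apply Real.log_le_log (by positivity)
      have : (c p : ℝ) ≤ n := by exact_mod_cast hcle p
      linarith
    linarith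
  rw [Finset.sum_sub_distrib] at hlow
  rw [Finset.sum_add_distrib, Finset.sum_sub_distrib] at hup
  have hs1 : ∑ j, (occ x j : ℝ) = n := by exact_mod_cast sum_occ_eq x
  have hs2 : ∑ p, (c p : ℝ) = n := by
    rw [Fintype.sum_prod_type, ← hs1]
    apply Finset.sum_congr rfl
    intro j _
    exact_mod_cast hc j
  have hs3 : ∑ _p : α × β, (Real.log ((n : ℝ) + 1) + 1)
      = (Fintype.card α * Fintype.card β : ℝ) * (Real.log (n + 1) + 1) := by
    simp
    ring
  simp only [hmR]
  have hK : (0 : ℝ) ≤ Fintype.card β := by positivity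
  rw [hs1] at hlow
  rw [hs2, hs3] at hup
  rw [hlogT', hlogcard, hlogP] at hlogT
  nlinarith

lemma cover_seq {ι Y : Type*} [Fintype ι] [Fintype Y] [Nonempty Y] [DecidableEq ι] [DecidableEq Y]
    (w : Y → ℝ) (hw : ∀ y, 0 ≤ w y) (hw1 : ∑ y, w y ≤ 1) (G : ι → Finset Y)
    (M : ℕ) (hM1 : 1 ≤ M) (hM : (Fintype.card ι : ℝ) < Real.exp M) :
    ∃ dec : ℕ → Y, ∀ u, 0 < ∑ y ∈ G u, w y → ∃ r : ℕ, 1 ≤ r ∧ dec r ∈ G u ∧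
      Real.log r ≤ -Real.log (∑ y ∈ G u, w y) + 2 * Real.log 2 + Real.log M := by
  have hlevel : ∀ L : ℕ, ∃ D : ℕ → Y, ∀ u, ((1 / 2 : ℝ) ^ L) ≤ ∑ y ∈ G u, w y →
      ∃ i < M * 2 ^ L, D i ∈ G u := by
    intro L
    set q : ℝ := (1 / 2) ^ L with hq
    have hq0 : 0 < q := by positivity
    have hq1 : q ≤ 1 := pow_le_one₀ (by norm_num) (by norm_num)
    obtain ⟨D, hD⟩ := greedy_cover w hw hw1 G
      (Finset.univ.filter fun u => q ≤ ∑ y ∈ G u, w y) q hq1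
      (fun u hu => (Finset.mem_filter.mp hu).2) (M * 2 ^ L)
    refine ⟨D, fun u hu => ?_⟩
    by_contra hcon
    push Not at hcon
    set S := (Finset.univ.filter fun u => q ≤ ∑ y ∈ G u, w y).filter
      fun u => ∀ i < M * 2 ^ L, D i ∉ G u with hS
    have hmem : u ∈ S := by
      simp only [hS, Finset.mem_filter, Finset.mem_univ, true_and]
      exact ⟨hu, hcon⟩
    have h1 : (1 : ℝ) ≤ S.card := by exact_mod_cast Finset.card_pos.mpr ⟨u, hmem⟩
    have h2 : (1 - q) ^ (M * 2 ^ L) ≤ Real.exp (-M) := by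
      have h3 : 1 - q ≤ Real.exp (-q) := by
        have := Real.add_one_le_exp (-q); linarith
      calc (1 - q) ^ (M * 2 ^ L) ≤ (Real.exp (-q)) ^ (M * 2 ^ L) :=
            pow_le_pow_left₀ (by linarith) h3 _
        _ = Real.exp (-M) := by
            rw [← Real.exp_nat_mul]
            congr 1
            push_cast
            have : (2 : ℝ) ^ L * q = 1 := by rw [hq, ← mul_pow]; norm_num
            linear_combination (-(M : ℝ)) * this
    have h4 : ((Finset.univ.filter fun u => q ≤ ∑ y ∈ G u, w y).card : ℝ) ≤ Fintype.card ι := by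
      exact_mod_cast Finset.card_le_univ _
    have h5 : (Fintype.card ι : ℝ) * Real.exp (-M) < 1 := by
      rw [Real.exp_neg, ← div_eq_mul_inv, div_lt_one (Real.exp_pos _)]
      exact hM
    have h6 : (S.card : ℝ) ≤ Fintype.card ι * Real.exp (-M) := by
      refine hD.trans ?_
      apply mul_le_mul h4 h2 (pow_nonneg (by linarith) _) (by positivity)
    linarith
  choose D hD using hlevel
  refine ⟨fun r => D (Nat.log 2 (r / M)) (r - M * 2 ^ (Nat.log 2 (r / M))), fun u hu => ?_⟩
  set S := ∑ y ∈ G u, w y with hS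
  have hS1 : S ≤ 1 :=
    (Finset.sum_le_univ_sum_of_nonneg hw).trans hw1
  have hl2 : 0 < Real.log 2 := Real.log_pos (by norm_num)
  have hlS : Real.log S ≤ 0 := Real.log_nonpos hu.le hS1
  set L : ℕ := ⌈-Real.log S / Real.log 2⌉₊ with hL
  have hL1 : -Real.log S ≤ L * Real.log 2 := by
    have := Nat.le_ceil (-Real.log S / Real.log 2)
    rwa [div_le_iff₀ hl2] at this
  have hL2 : (L : ℝ) * Real.log 2 ≤ -Real.log S + Real.log 2 := by
    have := (Nat.ceil_lt_add_one (a := -Real.log S / Real.log 2)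
      (div_nonneg (by linarith) hl2.le)).le
    have h2 := mul_le_mul_of_nonneg_right this hl2.le
    rw [add_mul, div_mul_cancel₀ _ hl2.ne', one_mul] at h2
    exact h2
  obtain ⟨i, hi, hiG⟩ := hD L u (by
    rw [← Real.log_le_log_iff (by positivity) hu, Real.log_pow]
    simp only [one_div, Real.log_inv]
    linarith)
  have hdiv : Nat.log 2 ((M * 2 ^ L + i) / M) = L := by
    rw [Nat.log_eq_iff (Or.inr ⟨by norm_num, ?_⟩)]
    · constructor
      · rw [Nat.le_div_iff_mul_le (by omega)]
        nlinarith
      · rw [Nat.div_lt_iff_lt_mul (by omega), pow_succ]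
        nlinarith
    · have : 2 ^ L ≤ (M * 2 ^ L + i) / M := by
        rw [Nat.le_div_iff_mul_le (by omega)]; nlinarith
      have := Nat.one_le_two_pow (n := L)
      omega
  have hpos : 1 ≤ M * 2 ^ L := Nat.mul_pos hM1 (by positivity)
  refine ⟨M * 2 ^ L + i, by omega, ?_, ?_⟩
  · simp only [hdiv, Nat.add_sub_cancel_left]
    exact hiG
  · have hMR : (0 : ℝ) < M := by exact_mod_cast hM1
    have hlt : ((M * 2 ^ L + i : ℕ) : ℝ) ≤ M * 2 ^ (L + 1) := by
      have : M * 2 ^ L + i ≤ M * 2 ^ (L + 1) := by rw [pow_succ]; nlinarith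
      exact_mod_cast this
    have := Real.log_le_log (by exact_mod_cast (by omega : 0 < M * 2 ^ L + i)) hlt
    rw [Real.log_mul hMR.ne' (by positivity), Real.log_pow] at this
    push_cast at this ⊢
    linarith

lemma rounding {α β : Type*} [DecidableEq α] [DecidableEq β] [Fintype α] [Fintype β]
    {n : ℕ} (x : Fin n → α) (Q : α → β → ℝ) (hQ : IsCondProb Q) (ρ : α → β → ℝ)
    (hρ : ∀ j k, 0 ≤ ρ j k) (hz : ∀ j, ∃ k, ρ j k = 0) :
    ∃ c : α × β → ℕ, (∀ j, ∑ k, c (j, k) = occ x j) ∧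
      (∀ p, (c p : ℝ) * ρ p.1 p.2 ≤ occ x p.1 * Q p.1 p.2 * ρ p.1 p.2) ∧
      ∀ p, |(c p : ℝ) - occ x p.1 * Q p.1 p.2| ≤ Fintype.card β := by
  choose k₀ hk₀ using hz
  set a : α → β → ℝ := fun j k => occ x j * Q j k with ha
  have ha0 : ∀ j k, 0 ≤ a j k := fun j k => mul_nonneg (by positivity) ((hQ j).1 k)
  have hasum : ∀ j, ∑ k, a j k = occ x j := by
    intro j
    simp only [ha]
    rw [← Finset.mul_sum, (hQ j).2, mul_one]
  set s : α → ℕ := fun j => ∑ k ∈ Finset.univ.erase (k₀ j), ⌊a j k⌋₊ with hs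
  have hsplit : ∀ j, a j (k₀ j) + ∑ k ∈ Finset.univ.erase (k₀ j), a j k = occ x j := by
    intro j
    rw [Finset.add_sum_erase _ _ (Finset.mem_univ _), hasum]
  have hsle : ∀ j, (s j : ℝ) ≤ ∑ k ∈ Finset.univ.erase (k₀ j), a j k := by
    intro j
    simp only [hs]
    push_cast
    exact Finset.sum_le_sum fun k _ => Nat.floor_le (ha0 j k)
  have hsge : ∀ j, ∑ k ∈ Finset.univ.erase (k₀ j), a j k ≤ s j + Fintype.card β := by
    intro j
    simp only [hs]
    push_cast
    calc ∑ k ∈ Finset.univ.erase (k₀ j), a j k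
        ≤ ∑ k ∈ Finset.univ.erase (k₀ j), ((⌊a j k⌋₊ : ℝ) + 1) :=
          Finset.sum_le_sum fun k _ => (Nat.lt_floor_add_one _).le
      _ = ∑ k ∈ Finset.univ.erase (k₀ j), (⌊a j k⌋₊ : ℝ)
          + ((Finset.univ.erase (k₀ j)).card : ℝ) := by
          rw [Finset.sum_add_distrib]; simp
      _ ≤ _ := by
          have : ((Finset.univ.erase (k₀ j)).card : ℝ) ≤ Fintype.card β := by
            exact_mod_cast Finset.card_le_univ _
          linarith
  have hsocc : ∀ j, s j ≤ occ x j := by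
    intro j
    have h1 := hsle j
    have h2 := hsplit j
    have h3 := ha0 j (k₀ j)
    have : (s j : ℝ) ≤ occ x j := by linarith
    exact_mod_cast this
  refine ⟨fun p => if p.2 = k₀ p.1 then occ x p.1 - s p.1 else ⌊a p.1 p.2⌋₊, ?_, ?_, ?_⟩
  · intro j
    rw [← Finset.add_sum_erase _ _ (Finset.mem_univ (k₀ j))]
    simp only [if_true]
    rw [Finset.sum_congr rfl (g := fun k => ⌊a j k⌋₊)
      (fun k hk => by simp [Finset.ne_of_mem_erase hk])]
    have := hsocc j
    simp only [hs] at this ⊢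
    omega
  · rintro ⟨j, k⟩
    by_cases hk : k = k₀ j
    · subst hk; simp [hk₀]
    · simp only [hk, if_false]
      exact mul_le_mul_of_nonneg_right (Nat.floor_le (ha0 j k)) (hρ j k)
  · rintro ⟨j, k⟩
    have hcard : (1 : ℝ) ≤ Fintype.card β := by
      exact_mod_cast Fintype.card_pos_iff.mpr ⟨k⟩
    by_cases hk : k = k₀ j
    · subst hk
      simp only [if_true]
      rw [Nat.cast_sub (hsocc j)]
      have h1 := hsle j
      have h2 := hsplit j
      have h3 := hsge j
      have h4 : (occ x j : ℝ) * Q j (k₀ j) = a j (k₀ j) := rfl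
      rw [h4, abs_le]
      constructor <;> linarith
    · simp only [hk, if_false]
      have h1 := Nat.floor_le (ha0 j k)
      have h2 := (Nat.lt_floor_add_one (a j k)).le
      have h4 : (occ x j : ℝ) * Q j k = a j k := rfl
      rw [h4, abs_le]
      constructor <;> linarith

lemma mi_identity {α β : Type*} [DecidableEq α] [DecidableEq β] [Fintype α] [Fintype β]
    {n : ℕ} (hn : 0 < n) (x : Fin n → α) (Q : α → β → ℝ) (hQ : IsCondProb Q) :
    (n : ℝ) * mutualInfo (typeOf x) Q =
      (n : ℝ) * Real.log n
        - ∑ k, (∑ j, occ x j * Q j k) * Real.log (∑ j, occ x j * Q j k)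
        - ∑ j, (occ x j : ℝ) * Real.log (occ x j)
        + ∑ p : α × β, (occ x p.1 * Q p.1 p.2) * Real.log (occ x p.1 * Q p.1 p.2) := by
  have hnR : (0 : ℝ) < n := by exact_mod_cast hn
  set b : β → ℝ := fun k => ∑ j, occ x j * Q j k with hb
  have hterm : ∀ j k, (n : ℝ) * (typeOf x j * Q j k *
      Real.log (Q j k / ∑ j', typeOf x j' * Q j' k))
      = (occ x j * Q j k) * Real.log (occ x j * Q j k)
        - (occ x j * Q j k) * Real.log (occ x j)
        - (occ x j * Q j k) * Real.log (b k) + (occ x j * Q j k) * Real.log n := by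
    intro j k
    have ht : ∀ j, typeOf x j = (occ x j : ℝ) / n := fun j => rfl
    have hsum : ∑ j', typeOf x j' * Q j' k = b k / n := by
      simp only [hb, ht]
      rw [Finset.sum_div]
      exact Finset.sum_congr rfl fun j _ => by ring
    rw [hsum, ht]
    have e : (n : ℝ) * ((occ x j : ℝ) / n * Q j k * Real.log (Q j k / (b k / n)))
        = (occ x j * Q j k) * Real.log (Q j k / (b k / n)) := by field_simp
    rw [e]
    by_cases h0 : (occ x j : ℝ) * Q j k = 0
    · simp [h0]
    · have ho : (occ x j : ℝ) ≠ 0 := left_ne_zero_of_mul h0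
      have hq : Q j k ≠ 0 := right_ne_zero_of_mul h0
      have hbk : b k ≠ 0 := by
        have hnn : ∀ j, 0 ≤ (occ x j : ℝ) * Q j k :=
          fun j => mul_nonneg (by positivity) ((hQ j).1 k)
        have h1 : (occ x j : ℝ) * Q j k ≤ b k :=
          Finset.single_le_sum (f := fun j => (occ x j : ℝ) * Q j k)
            (fun j _ => hnn j) (Finset.mem_univ j)
        have h2 : 0 < (occ x j : ℝ) * Q j k := lt_of_le_of_ne (hnn j) (Ne.symm h0)
        linarith
      rw [Real.log_div hq (div_ne_zero hbk hnR.ne'), Real.log_div hbk hnR.ne',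
        Real.log_mul ho hq]
      ring
  have hrow : ∀ j, ∑ k, (occ x j : ℝ) * Q j k = occ x j := by
    intro j
    rw [← Finset.mul_sum, (hQ j).2, mul_one]
  have hs1 : ∑ j, (occ x j : ℝ) = n := by exact_mod_cast sum_occ_eq x
  unfold mutualInfo
  rw [Finset.mul_sum]
  simp only [Finset.mul_sum, hterm]
  simp only [Finset.sum_add_distrib, Finset.sum_sub_distrib]
  have e1 : ∑ j, ∑ k, (occ x j * Q j k) * Real.log (occ x j)
      = ∑ j, (occ x j : ℝ) * Real.log (occ x j) := by
    apply Finset.sum_congr rfl; intro j _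
    rw [← Finset.sum_mul, hrow]
  have e2 : ∑ j, ∑ k, (occ x j * Q j k) * Real.log (b k) = ∑ k, b k * Real.log (b k) := by
    rw [Finset.sum_comm]
    apply Finset.sum_congr rfl; intro k _
    rw [← Finset.sum_mul]
  have e3 : ∑ j, ∑ k, (occ x j * Q j k) * Real.log n = n * Real.log n := by
    simp only [← Finset.sum_mul, hrow, hs1]
  rw [e1, e2, e3, Fintype.sum_prod_type]
  ring

/-- Type covering estimate: every feasible test channel can be rounded to a conditional type whose
shell is feasible and has large weight. -/
lemma good_shell {α β : Type*} [DecidableEq α] [DecidableEq β] [Fintype α] [Fintype β]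
    {n : ℕ} (hn : 0 < n) (x : Fin n → α) (Q : α → β → ℝ) (hQ : IsCondProb Q) (ρ : α → β → ℝ)
    (hρ : ∀ j k, 0 ≤ ρ j k) (hz : ∀ j, ∃ k, ρ j k = 0) (d : ℝ)
    (hd : avgDist (typeOf x) Q ρ ≤ d) (Jr Kr : ℝ) (hJr : Jr = Fintype.card α)
    (hKr : Kr = Fintype.card β) :
    ∃ c : α × β → ℕ, (∀ p, c p ≤ n) ∧ (∀ y ∈ shell x c, nDist ρ x y ≤ d) ∧
      0 < ∑ y ∈ shell x c, wt n y ∧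
      -Real.log (∑ y ∈ shell x c, wt n y) ≤ n * mutualInfo (typeOf x) Q +
        (Kr + Jr * Kr + Jr * Kr * (Kr + 1) + Kr * (Jr * Kr + 1)) * (Real.log (n + 1) + 1) := by
  have hnR : (0 : ℝ) < n := by exact_mod_cast hn
  have hn1 : (1 : ℝ) ≤ n := by exact_mod_cast hn
  obtain ⟨c, hc, hdist, hclose⟩ := rounding x Q hQ ρ hρ hz
  have hsocc : ∑ j, (occ x j : ℝ) = n := by exact_mod_cast sum_occ_eq x
  have hoccle : ∀ j, occ x j ≤ n := fun j => by
    calc occ x j ≤ ∑ j, occ x j := Finset.single_le_sum (fun _ _ => Nat.zero_le _) (Finset.mem_univ j)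
      _ = n := sum_occ_eq x
  have hcle : ∀ p, c p ≤ n := by
    rintro ⟨j, k⟩
    calc c (j, k) ≤ ∑ k, c (j, k) :=
          Finset.single_le_sum (f := fun k => c (j, k)) (fun _ _ => Nat.zero_le _) (Finset.mem_univ k)
      _ = occ x j := hc j
      _ ≤ n := hoccle j
  have ha0 : ∀ j k, 0 ≤ (occ x j : ℝ) * Q j k :=
    fun j k => mul_nonneg (by positivity) ((hQ j).1 k)
  have hQ1 : ∀ j k, Q j k ≤ 1 := fun j k => by
    rw [← (hQ j).2]
    exact Finset.single_le_sum (fun k _ => (hQ j).1 k) (Finset.mem_univ k)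
  obtain ⟨hpos, hw⟩ := shell_weight hn x c hc
  refine ⟨c, hcle, ?_, hpos, ?_⟩
  · intro y hy
    simp only [shell, Finset.mem_filter] at hy
    have h1 : ∑ i, ρ (x i) (y i) = ∑ p : α × β, (c p : ℝ) * ρ p.1 p.2 := by
      rw [sum_occ (fun i => (x i, y i)) (fun p => ρ p.1 p.2)]
      exact Finset.sum_congr rfl fun p _ => by rw [hy.2 p]
    have h2 : ∑ p : α × β, (occ x p.1 * Q p.1 p.2 * ρ p.1 p.2) = n * avgDist (typeOf x) Q ρ := by
      unfold avgDist
      rw [Fintype.sum_prod_type, Finset.mul_sum]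
      apply Finset.sum_congr rfl; intro j _
      rw [Finset.mul_sum]
      apply Finset.sum_congr rfl; intro k _
      have ht : typeOf x j = (occ x j : ℝ) / n := rfl
      rw [ht]; field_simp
    unfold nDist
    rw [div_le_iff₀ hnR, h1]
    calc _ ≤ ∑ p : α × β, (occ x p.1 * Q p.1 p.2 * ρ p.1 p.2) :=
          Finset.sum_le_sum fun p _ => hdist p
      _ = n * avgDist (typeOf x) Q ρ := h2
      _ ≤ n * d := by gcongr
      _ = d * n := mul_comm _ _
  · rw [mi_identity hn x Q hQ]
    rw [← hJr, ← hKr] at hw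
    rw [← hKr] at hclose
    have hJ0 : 0 ≤ Jr := by rw [hJr]; positivity
    have hK0 : 0 ≤ Kr := by rw [hKr]; positivity
    set l := Real.log ((n : ℝ) + 1) + 1 with hl
    have hlog : Real.log n ≤ Real.log ((n : ℝ) + 1) := Real.log_le_log hnR (by linarith)
    have hlog0 : 0 ≤ Real.log (n : ℝ) := Real.log_nonneg hn1
    have hl1 : 1 ≤ l := by linarith
    have step1 : ∑ p, (c p : ℝ) * Real.log (c p)
        ≤ ∑ p : α × β, (occ x p.1 * Q p.1 p.2) * Real.log (occ x p.1 * Q p.1 p.2)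
          + Jr * Kr * ((Kr + 1) * l) := by
      have : ∑ p : α × β, (((occ x p.1 * Q p.1 p.2) * Real.log (occ x p.1 * Q p.1 p.2))
          + (Kr + 1) * l) = ∑ p : α × β, (occ x p.1 * Q p.1 p.2) * Real.log (occ x p.1 * Q p.1 p.2)
          + Jr * Kr * ((Kr + 1) * l) := by
        rw [Finset.sum_add_distrib, Finset.sum_const, Finset.card_univ, Fintype.card_prod,
          nsmul_eq_mul, Nat.cast_mul, ← hJr, ← hKr]
      rw [← this]
      apply Finset.sum_le_sum
      rintro ⟨j, k⟩ _
      have h1 := xlogx_diff (a := (c (j, k) : ℝ)) (b := occ x j * Q j k) (L := Kr) (N := n)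
        (by positivity) (ha0 j k) (by exact_mod_cast hcle (j, k))
        (by
          have : (occ x j : ℝ) ≤ n := by exact_mod_cast hoccle j
          calc (occ x j : ℝ) * Q j k ≤ n * 1 :=
                mul_le_mul this (hQ1 j k) ((hQ j).1 k) hnR.le
            _ = n := mul_one _)
        hn1 (hclose (j, k))
      have h2 : Kr * (Real.log n + 1) + 1 ≤ (Kr + 1) * l := by nlinarith
      simp only
      linarith
    have step2 : ∑ k, (∑ j, (occ x j : ℝ) * Q j k) * Real.log (∑ j, (occ x j : ℝ) * Q j k)
        ≤ ∑ k, (∑ j, (c (j, k) : ℝ)) * Real.log (∑ j, (c (j, k) : ℝ))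
          + Kr * ((Jr * Kr + 1) * l) := by
      have : ∑ k, ((∑ j, (c (j, k) : ℝ)) * Real.log (∑ j, (c (j, k) : ℝ)) + (Jr * Kr + 1) * l)
          = ∑ k, (∑ j, (c (j, k) : ℝ)) * Real.log (∑ j, (c (j, k) : ℝ))
          + Kr * ((Jr * Kr + 1) * l) := by
        rw [Finset.sum_add_distrib, Finset.sum_const, Finset.card_univ, nsmul_eq_mul, ← hKr]
      rw [← this]
      apply Finset.sum_le_sum
      intro k _
      have h1 := xlogx_diff (a := ∑ j, (occ x j : ℝ) * Q j k) (b := ∑ j, (c (j, k) : ℝ))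
        (L := Jr * Kr) (N := n)
        (Finset.sum_nonneg fun j _ => ha0 j k) (by positivity)
        (by
          rw [← hsocc]
          apply Finset.sum_le_sum
          intro j _
          calc (occ x j : ℝ) * Q j k ≤ occ x j * 1 := by
                apply mul_le_mul_of_nonneg_left (hQ1 j k) (by positivity)
            _ = _ := mul_one _)
        (by
          rw [← hsocc]
          apply Finset.sum_le_sum
          intro j _
          have : c (j, k) ≤ occ x j := by
            rw [← hc j]
            exact Finset.single_le_sum (f := fun k => c (j, k)) (fun _ _ => Nat.zero_le _)
              (Finset.mem_univ k)
          exact_mod_cast this)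
        hn1
        (by
          rw [← Finset.sum_sub_distrib]
          calc _ ≤ ∑ j, |(occ x j : ℝ) * Q j k - c (j, k)| := Finset.abs_sum_le_sum_abs _ _
            _ ≤ ∑ _j : α, Kr := by
                apply Finset.sum_le_sum
                intro j _
                rw [abs_sub_comm]
                exact hclose (j, k)
            _ = Jr * Kr := by simp [hJr])
      have hJK : 0 ≤ Jr * Kr := mul_nonneg hJ0 hK0
      have h2 : Jr * Kr * (Real.log n + 1) + 1 ≤ (Jr * Kr + 1) * l := by nlinarith
      linarith
    nlinarith

lemma sequence_code {α β : Type*} [DecidableEq α] [DecidableEq β] [Fintype α] [Fintype β]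
    [Nonempty β] {n : ℕ} (hn : 0 < n) (Jr Kr : ℝ) (hJr : Jr = Fintype.card α)
    (hKr : Kr = Fintype.card β) :
    ∃ dec : ℕ → (Fin n → β), ∀ (x : Fin n → α) (ρ : α → β → ℝ) (d : ℝ) (Q : α → β → ℝ),
      (∀ j k, 0 ≤ ρ j k) → (∀ j, ∃ k, ρ j k = 0) → IsCondProb Q →
      avgDist (typeOf x) Q ρ ≤ d → ∃ r : ℕ, 1 ≤ r ∧ nDist ρ x (dec r) ≤ d ∧
      Real.log r ≤ n * mutualInfo (typeOf x) Q +
        (Kr + Jr * Kr + Jr * Kr * (Kr + 1) + Kr * (Jr * Kr + 1)) * (Real.log (n + 1) + 1)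
        + 2 * Real.log 2 + (Jr + Jr * Kr + 2) * (Real.log (n + 1) + 1) := by
  set M : ℕ := n * (Fintype.card α + Fintype.card α * Fintype.card β) + 1 with hM
  have hcard : (Fintype.card ((Fin n → α) × (α × β → Fin (n + 1))) : ℝ) < Real.exp M := by
    simp only [Fintype.card_prod, Fintype.card_fun, Fintype.card_fin]
    push_cast
    have h1 : (Fintype.card α : ℝ) ≤ Real.exp (Fintype.card α) := by
      have := Real.add_one_le_exp (Fintype.card α : ℝ); linarith
    have h2 : (n : ℝ) + 1 ≤ Real.exp n := Real.add_one_le_exp _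
    calc (Fintype.card α : ℝ) ^ n * (n + 1 : ℝ) ^ (Fintype.card α * Fintype.card β)
        ≤ (Real.exp (Fintype.card α)) ^ n * (Real.exp n) ^ (Fintype.card α * Fintype.card β) := by
          gcongr
      _ = Real.exp (n * (Fintype.card α + Fintype.card α * Fintype.card β)) := by
          rw [← Real.exp_nat_mul, ← Real.exp_nat_mul, ← Real.exp_add]
          congr 1
          push_cast
          ring
      _ < Real.exp M := by
          apply Real.exp_lt_exp.mpr
          rw [hM]; push_cast; linarith
  obtain ⟨dec, hdec⟩ := cover_seq (wt (β := β) n) (wt_nonneg n) (wt_sum n)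
    (fun u : (Fin n → α) × (α × β → Fin (n + 1)) => shell u.1 (fun p => (u.2 p : ℕ))) M
    (by omega) hcard
  refine ⟨dec, fun x ρ d Q hρ hz hQ hd => ?_⟩
  obtain ⟨c, hcle, hgood, hpos, hlog⟩ := good_shell hn x Q hQ ρ hρ hz d hd Jr Kr hJr hKr
  obtain ⟨r, hr1, hr2, hr3⟩ := hdec (x, fun p => ⟨c p, by have := hcle p; omega⟩) hpos
  simp only at hr2 hr3
  refine ⟨r, hr1, hgood _ hr2, ?_⟩
  have hJ0 : 0 ≤ Jr := by rw [hJr]; positivity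
  have hK0 : 0 ≤ Kr := by rw [hKr]; positivity
  have hJK : 0 ≤ Jr * Kr := mul_nonneg hJ0 hK0
  have hMlog : Real.log M ≤ (Jr + Jr * Kr + 2) * (Real.log (n + 1) + 1) := by
    have hMR : (M : ℝ) ≤ (Jr + Jr * Kr + 1) * (n + 1) := by
      rw [hM]; push_cast; rw [← hJr, ← hKr]
      nlinarith
    have hM0 : (0 : ℝ) < M := by rw [hM]; positivity
    have h1 := Real.log_le_log hM0 hMR
    rw [Real.log_mul (by positivity) (by positivity)] at h1
    have h2 := Real.log_le_sub_one_of_pos (show 0 < Jr + Jr * Kr + 1 by positivity)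
    have h3 : 0 ≤ Real.log ((n : ℝ) + 1) := Real.log_nonneg (by linarith [(Nat.cast_nonneg n : (0:ℝ) ≤ n)])
    nlinarith
  linarith

lemma bits_decode (r : ℕ) :
    Nat.ofDigits 2 (r.bits.map fun b => cond b 1 0) = r := by
  have := Nat.digits_two_eq_bits r
  rw [← this]
  exact Nat.ofDigits_digits 2 r

lemma bits_len (r : ℕ) (hr : 1 ≤ r) :
    Real.log 2 * (r.bits.length : ℝ) ≤ Real.log r + Real.log 2 := by
  rw [Nat.size_eq_bits_len]
  have h0 : 0 < r.size := Nat.size_pos.mpr hr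
  have h1 : 2 ^ (r.size - 1) ≤ r := Nat.lt_size.mp (by omega)
  have h2 : ((2 : ℝ) ^ (r.size - 1)) ≤ r := by exact_mod_cast h1
  have h3 := Real.log_le_log (by positivity) h2
  rw [Real.log_pow, Nat.cast_sub h0] at h3
  push_cast at h3
  linarith

lemma det_code {α β : Type*} [DecidableEq α] [DecidableEq β] [Fintype α] [Fintype β]
    [Nonempty β] {n : ℕ} (hn : 0 < n) (ρmax d : ℝ) (hd : 0 < d) (Jr Kr : ℝ)
    (hJr : Jr = Fintype.card α) (hKr : Kr = Fintype.card β) :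
    ∃ (φ : (Fin n → α) → (α → β → ℝ) → (Fin n → β)) (f : (Fin n → β) → List Bool)
      (g : List Bool → (Fin n → β)),
      (∀ x ρ, IsDistMeasure ρmax ρ → nDist ρ x (φ x ρ) ≤ d) ∧
      (∀ x ρ, IsDistMeasure ρmax ρ → g (f (φ x ρ)) = φ x ρ) ∧
      (∀ x ρ, IsDistMeasure ρmax ρ → Real.log 2 * ((f (φ x ρ)).length : ℝ) ≤
        n * RD (typeOf x) d ρ +
        ((Kr + Jr * Kr + Jr * Kr * (Kr + 1) + Kr * (Jr * Kr + 1)) + (Jr + Jr * Kr + 2) + 3)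
          * (Real.log (n + 1) + 1)) := by
  classical
  have hnR : (0 : ℝ) < n := by exact_mod_cast hn
  obtain ⟨dec, hdec⟩ := sequence_code (α := α) (β := β) hn Jr Kr hJr hKr
  -- the zero distortion test channel
  have hzero : ∀ ρ : α → β → ℝ, IsDistMeasure ρmax ρ → ∀ x : Fin n → α,
      ∃ Q, IsCondProb Q ∧ avgDist (typeOf x) Q ρ ≤ d := by
    intro ρ hρ x
    choose k₀ hk₀ using hρ.2
    refine ⟨fun j k => if k = k₀ j then 1 else 0, fun j => ⟨fun k => ?_, ?_⟩, ?_⟩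
    · dsimp only
      split_ifs <;> norm_num
    · simp
    · have : avgDist (typeOf x) (fun j k => if k = k₀ j then 1 else 0) ρ = 0 := by
        unfold avgDist
        simp [hk₀]
      rw [this]; exact hd.le
  have hex : ∀ ρ : α → β → ℝ, IsDistMeasure ρmax ρ → ∀ x : Fin n → α,
      ∃ r, nDist ρ x (dec r) ≤ d := by
    intro ρ hρ x
    obtain ⟨Q, hQ, hQd⟩ := hzero ρ hρ x
    obtain ⟨r, _, hr, _⟩ := hdec x ρ d Q (fun j k => (hρ.1 j k).1) hρ.2 hQ hQd
    exact ⟨r, hr⟩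
  set idx : (Fin n → α) → (α → β → ℝ) → ℕ := fun x ρ => sInf {r | nDist ρ x (dec r) ≤ d} with hidx
  set ind : (Fin n → β) → ℕ := fun y => sInf {r | dec r = y} with hind
  refine ⟨fun x ρ => dec (idx x ρ), fun y => (ind y).bits,
    fun l => dec (Nat.ofDigits 2 (l.map fun b => cond b 1 0)), ?_, ?_, ?_⟩
  · intro x ρ hρ
    exact Nat.sInf_mem (s := {r | nDist ρ x (dec r) ≤ d}) (hex ρ hρ x)
  · intro x ρ hρ
    simp only [bits_decode]
    exact Nat.sInf_mem (s := {r | dec r = dec (idx x ρ)}) ⟨_, rfl⟩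
  · intro x ρ hρ
    set C := (Kr + Jr * Kr + Jr * Kr * (Kr + 1) + Kr * (Jr * Kr + 1)) with hC
    set len := Real.log 2 * (((ind (dec (idx x ρ))).bits.length : ℕ) : ℝ) with hlen
    have hl2 : 0 < Real.log 2 := Real.log_pos (by norm_num)
    have hl2' : Real.log 2 ≤ 1 := by
      have := Real.log_le_sub_one_of_pos (show (0 : ℝ) < 2 by norm_num); linarith
    have hlogn : 0 ≤ Real.log ((n : ℝ) + 1) := Real.log_nonneg (by linarith)
    have hmain : ∀ Q, IsCondProb Q → avgDist (typeOf x) Q ρ ≤ d →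
        len ≤ n * mutualInfo (typeOf x) Q
          + (C + (Jr + Jr * Kr + 2) + 3) * (Real.log (n + 1) + 1) := by
      intro Q hQ hQd
      obtain ⟨r, hr1, hr2, hr3⟩ := hdec x ρ d Q (fun j k => (hρ.1 j k).1) hρ.2 hQ hQd
      have h1 : idx x ρ ≤ r := Nat.sInf_le hr2
      have h2 : ind (dec (idx x ρ)) ≤ idx x ρ := Nat.sInf_le rfl
      have h3 : (ind (dec (idx x ρ))).bits.length ≤ r.bits.length := by
        rw [Nat.size_eq_bits_len, Nat.size_eq_bits_len]
        exact Nat.size_le_size (h2.trans h1)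
      have h4 : len ≤ Real.log 2 * (r.bits.length : ℝ) := by
        apply mul_le_mul_of_nonneg_left _ hl2.le
        exact_mod_cast h3
      have h5 := bits_len r hr1
      nlinarith
    have hRD : (len - (C + (Jr + Jr * Kr + 2) + 3) * (Real.log (n + 1) + 1)) / n
        ≤ RD (typeOf x) d ρ := by
      unfold RD
      apply le_csInf
      · obtain ⟨Q, hQ, hQd⟩ := hzero ρ hρ x
        exact ⟨_, Q, hQ, hQd, rfl⟩
      · rintro _ ⟨Q, hQ, hQd, rfl⟩
        rw [div_le_iff₀ hnR]
        have := hmain Q hQ hQd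
        linarith
    rw [div_le_iff₀ hnR] at hRD
    linarith

lemma prodProb_sum {α : Type*} [Fintype α] [DecidableEq α] {n : ℕ} (p : α → ℝ) (hp : IsProb p) :
    ∑ x : Fin n → α, prodProb p x = 1 := by
  unfold prodProb
  rw [← Fintype.sum_pow, hp.2, one_pow]

lemma prodProb_nonneg {α : Type*} [Fintype α] {n : ℕ} (p : α → ℝ) (hp : IsProb p)
    (x : Fin n → α) : 0 ≤ prodProb p x :=
  Finset.prod_nonneg fun i _ => hp.1 _

lemma final_asymp (C V c : ℝ) (hC : 0 ≤ C) (hc : 0 < c) :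
    ∃ N : ℕ, 3 ≤ N ∧ ∀ n : ℕ, N ≤ n →
      C * (Real.log (n + 1) + 1) / n ≤
        c * Real.log n / (n : ℝ) ^ ((5 : ℝ) / 8) + V / n := by
  have ht : Tendsto (fun n : ℕ => (n : ℝ) ^ ((3 : ℝ) / 8)) atTop atTop :=
    (tendsto_rpow_atTop (by norm_num)).comp tendsto_natCast_atTop_atTop
  obtain ⟨N₀, hN₀⟩ := Filter.eventually_atTop.mp
    (ht.eventually_ge_atTop ((3 * C + |V|) / c))
  refine ⟨max N₀ 3, le_max_right _ _, fun n hn => ?_⟩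
  have hn3 : 3 ≤ n := le_trans (le_max_right _ _) hn
  have hn3R : (3 : ℝ) ≤ n := by exact_mod_cast hn3
  have hnR : (0 : ℝ) < n := by linarith
  have hlog1 : 1 ≤ Real.log n := by
    rw [Real.le_log_iff_exp_le hnR]
    have := Real.exp_one_lt_d9
    linarith
  have hlogs : Real.log ((n : ℝ) + 1) + 1 ≤ 3 * Real.log n := by
    have h1 : Real.log ((n : ℝ) + 1) ≤ Real.log ((n : ℝ) ^ 2) :=
      Real.log_le_log (by linarith) (by nlinarith)
    rw [Real.log_pow] at h1
    push_cast at h1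
    linarith
  have hpow := hN₀ n (le_trans (le_max_left _ _) hn)
  rw [div_le_iff₀ hc] at hpow
  set s := (n : ℝ) ^ ((3 : ℝ) / 8) with hs
  have hsn : (n : ℝ) ^ ((5 : ℝ) / 8) * s = n := by
    rw [hs, ← Real.rpow_add hnR]; norm_num
  have h5 : 0 < (n : ℝ) ^ ((5 : ℝ) / 8) := Real.rpow_pos_of_pos hnR _
  have e : c * Real.log n / (n : ℝ) ^ ((5 : ℝ) / 8) = c * Real.log n * s / n := by
    rw [div_eq_div_iff h5.ne' hnR.ne']
    linear_combination (-(c * Real.log n)) * hsn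
  rw [e, ← add_div]
  apply div_le_div_of_nonneg_right _ hnR.le
  have h6 := neg_abs_le V
  have h7 : |V| ≤ |V| * Real.log n := le_mul_of_one_le_right (abs_nonneg V) hlog1
  have h8 := mul_le_mul_of_nonneg_left hlogs hC
  have h9 := mul_le_mul_of_nonneg_right hpow (by linarith : (0 : ℝ) ≤ Real.log n)
  nlinarith

/-- Theorem 1: for sufficiently large `n` there is a random
non-prefix `d`-semifaithful code in the universal distortion setting whose
expected rate exceeds `E_p[R(T,d,ρ)]` by at most the stated bound, uniformly
over all sources `p` and distortion measures `ρ ∈ D`. -/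
theorem random_nonprefix_universal_code (J K : ℕ) (hJ : 0 < J) (hK : 0 < K)
    (ρmax : ℝ) (hρmax : 0 < ρmax) (d : ℝ) (hd : 0 < d) :
    ∃ N : ℕ, ∀ n : ℕ, N ≤ n →
      ∃ (Ω : Type) (_ : MeasurableSpace Ω) (μ : Measure Ω),
        IsProbabilityMeasure μ ∧
        ∃ (φ : Ω → (Fin n → Fin J) → (Fin J → Fin K → ℝ) → (Fin n → Fin K))
          (f : Ω → (Fin n → Fin K) → List Bool)
          (g : Ω → List Bool → (Fin n → Fin K)),
          -- d-semifaithful for every realization of the code, every sequence, every ρ ∈ D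
          (∀ ω x ρ, IsDistMeasure ρmax ρ → nDist ρ x (φ ω x ρ) ≤ d) ∧
          -- lossless binary encoder/decoder pair on the codebook
          (∀ ω x ρ, IsDistMeasure ρmax ρ → g ω (f ω (φ ω x ρ)) = φ ω x ρ) ∧
          -- uniform expected-rate bound
          (∀ (p : Fin J → ℝ), IsProb p → ∀ ρ : Fin J → Fin K → ℝ, IsDistMeasure ρmax ρ →
            (1 / (n : ℝ)) * (∑ x : Fin n → Fin J, prodProb p x *
                (Real.log 2 * ∫ ω, ((f ω (φ ω x ρ)).length : ℝ) ∂μ))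
              - expTypeRD n p d ρ
            ≤ 2 * ρmax * Real.log n / (d * (n : ℝ) ^ ((5 : ℝ) / 8))
              + 4 * ρmax * (min (Real.log K) (Real.log J) + Real.log 2)
                  / (d * (n : ℝ) ^ ((5 : ℝ) / 8))
              + (((K : ℝ) + 5 / 4) / 2) * (Real.log n / n)
              + ((Real.log (Real.Gamma (1 / 2) ^ K /
                    ((2 * Real.pi) ^ (((K : ℝ) - 1) / 2) * Real.Gamma ((K : ℝ) / 2)))
                  + 2 * Real.log 2) + Real.log 8) / n
              + min (Real.log K) (Real.log J) / n) := by
  have hlogK : 0 ≤ Real.log K := Real.log_natCast_nonneg K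
  have hlogJ : 0 ≤ Real.log J := Real.log_natCast_nonneg J
  have hmin : 0 ≤ min (Real.log K) (Real.log J) := le_min hlogK hlogJ
  have hl2 : 0 < Real.log 2 := Real.log_pos (by norm_num)
  set V : ℝ := (Real.log (Real.Gamma (1 / 2) ^ K /
      ((2 * Real.pi) ^ (((K : ℝ) - 1) / 2) * Real.Gamma ((K : ℝ) / 2)))
      + 2 * Real.log 2) + Real.log 8 with hV
  set Jr : ℝ := (J : ℝ) with hJr
  set Kr : ℝ := (K : ℝ) with hKr
  have hJr0 : 0 ≤ Jr := by rw [hJr]; positivity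
  have hKr0 : 0 ≤ Kr := by rw [hKr]; positivity
  set C : ℝ := ((Kr + Jr * Kr + Jr * Kr * (Kr + 1) + Kr * (Jr * Kr + 1))
    + (Jr + Jr * Kr + 2) + 3) with hC
  have hC0 : 0 ≤ C := by positivity
  obtain ⟨N, hN3, hN⟩ := final_asymp C V (2 * ρmax / d) hC0 (by positivity)
  refine ⟨N, fun n hn => ?_⟩
  have hn0 : 0 < n := by omega
  have hnR : (0 : ℝ) < n := by exact_mod_cast hn0
  have hn1 : (1 : ℝ) ≤ n := by exact_mod_cast hn0
  haveI : Nonempty (Fin K) := ⟨⟨0, hK⟩⟩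
  obtain ⟨φ, f, g, hφ, hfg, hlen⟩ := det_code (α := Fin J) (β := Fin K) hn0 ρmax d hd Jr Kr
    (by simp [hJr]) (by simp [hKr])
  refine ⟨Unit, inferInstance, Measure.dirac (), inferInstance, fun _ => φ, fun _ => f, fun _ => g,
    fun _ => hφ, fun _ => hfg, fun p hp ρ hρ => ?_⟩
  have hbound : (1 / (n : ℝ)) * (∑ x : Fin n → Fin J, prodProb p x *
      (Real.log 2 * ∫ _ω : Unit, ((f (φ x ρ)).length : ℝ) ∂(Measure.dirac ())))
      - expTypeRD n p d ρ ≤ C * (Real.log (n + 1) + 1) / n := by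
    have h1 : ∑ x : Fin n → Fin J, prodProb p x *
        (Real.log 2 * ∫ _ω : Unit, ((f (φ x ρ)).length : ℝ) ∂(Measure.dirac ()))
        ≤ n * expTypeRD n p d ρ + C * (Real.log (n + 1) + 1) := by
      have h2 : (n : ℝ) * expTypeRD n p d ρ + C * (Real.log (n + 1) + 1)
          = ∑ x : Fin n → Fin J, prodProb p x *
            (n * RD (typeOf x) d ρ + C * (Real.log (n + 1) + 1)) := by
        simp only [mul_add, Finset.sum_add_distrib]
        rw [← Finset.sum_mul, ← Finset.sum_mul, prodProb_sum p hp]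
        unfold expTypeRD
        rw [Finset.mul_sum]
        have : ∀ x : Fin n → Fin J, (n : ℝ) * (prodProb p x * RD (typeOf x) d ρ)
            = prodProb p x * (n * RD (typeOf x) d ρ) := fun x => by ring
        simp only [this]
        ring
      rw [h2]
      apply Finset.sum_le_sum
      intro x _
      apply mul_le_mul_of_nonneg_left _ (prodProb_nonneg p hp x)
      simp only [integral_const, probReal_univ, one_smul]
      exact hlen x ρ hρ
    have h3 : (1 / (n : ℝ)) * (n * expTypeRD n p d ρ + C * (Real.log (n + 1) + 1))
        = expTypeRD n p d ρ + C * (Real.log (n + 1) + 1) / n := by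
      field_simp
    have h4 := mul_le_mul_of_nonneg_left h1 (by positivity : 0 ≤ 1 / (n : ℝ))
    linarith
  have hasy := hN n hn
  have e1 : 2 * ρmax / d * Real.log n / (n : ℝ) ^ ((5 : ℝ) / 8)
      = 2 * ρmax * Real.log n / (d * (n : ℝ) ^ ((5 : ℝ) / 8)) := by
    field_simp
  rw [e1] at hasy
  have hlogn : 0 ≤ Real.log n := Real.log_nonneg hn1
  have t1 : 0 ≤ 4 * ρmax * (min (Real.log K) (Real.log J) + Real.log 2)
      / (d * (n : ℝ) ^ ((5 : ℝ) / 8)) := by positivity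
  have t2 : 0 ≤ ((Kr + 5 / 4) / 2) * (Real.log n / n) := by positivity
  have t3 : 0 ≤ min (Real.log K) (Real.log J) / n := by positivity
  linarith
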